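/- Let n ≥ 1, k ≥ 0 and k+1 ≤ l ≤ n+k−1. Then p^l_{n,n+k;≤n+k} − p^{l+1}_{n,n+k;≤n+k} = C(n−1, l−k−1) · p_{l−k−1, l−1; ≤ l−1} · p_{n+k−l}, where C(a,b) is the binomial coefficient. -/

import Mathlib

/-- One parking step: a car with preference `a` parks in the first unoccupied
space `j` with `a ≤ j ≤ m`, if such a space exists; otherwise it leaves. -/
def parkStep (m : ℕ) (occ : Finset ℕ) (a : ℕ) : Finset ℕ :=
  if h : ((Finset.Icc a m) \ occ).Nonempty then
    insert (((Finset.Icc a m) \ occ).min' h) occ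
  else occ

/-- The set of occupied spaces after the cars with preference list `l`
(in order of arrival) have tried to park among spaces `1, …, m`. -/
def occupied (m : ℕ) (l : List ℕ) : Finset ℕ := l.foldl (parkStep m) ∅

/-- The number of cars that leave unparked. -/
def flaws (m : ℕ) (l : List ℕ) : ℕ := l.length - (occupied m l).card

/-- The preference list (with entries in `[1, s]`) encoded by a function `Fin n → Fin s`. -/
def prefList {n s : ℕ} (f : Fin n → Fin s) : List ℕ :=
  (List.ofFn f).map (fun i => (i : ℕ) + 1)

/-- `p n m s k` is the number of `k`-flaw preference sets of length `n` with `m`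
parking spaces, all of whose entries are at most `s`. -/
def p (n m s k : ℕ) : ℕ :=
  (Finset.univ.filter (fun f : Fin n → Fin s => flaws m (prefList f) = k)).card

/-- `pL n m s k l` is the number of `k`-flaw preference sets of length `n` with `m`
parking spaces, entries at most `s`, and first entry `l`. -/
def pL (n m s k l : ℕ) : ℕ :=
  (Finset.univ.filter (fun f : Fin n → Fin s =>
    flaws m (prefList f) = k ∧ (prefList f).head? = some l)).card

/-- The set of empty spaces. -/
def empties (m : ℕ) (l : List ℕ) : Finset ℕ := Finset.Icc 1 m \ occupied m l

/-- `n_α`: the number of entries equal to the first entry. -/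
def nstat (l : List ℕ) : ℕ := l.count l.headI

/-- `h_α`: the number of empty spaces smaller than the first entry. -/
def hstat (m : ℕ) (l : List ℕ) : ℕ := ((empties m l).filter (fun x => x < l.headI)).card

/-- `τ_α`: the number of entries smaller than the first entry, plus one. -/
def taustat (l : List ℕ) : ℕ := l.countP (fun a => a < l.headI) + 1

/-- `m_α`: the largest empty space. -/
def mstat (m : ℕ) (l : List ℕ) : ℕ := (empties m l).sup id

/-- Number of entries that are at least `j`. -/
def cnt {ι : Type} [Fintype ι] (f : ι → ℕ) (j : ℕ) : ℕ := ∑ i, if j ≤ f i then 1 else 0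

/-- Zero-indexed parking condition. -/
def isPF {ι : Type} [Fintype ι] (f : ι → ℕ) (m : ℕ) : Prop := ∀ j ≤ m, cnt f j + j ≤ m

open Classical in
/-- The finset of zero-indexed parking functions on an index type. -/
noncomputable def PF (ι : Type) [Fintype ι] (m : ℕ) : Finset (ι → ℕ) :=
  (Fintype.piFinset (fun _ => Finset.range m)).filter (fun f => isPF f m)

theorem isPF.lt {ι : Type} [Fintype ι] {f : ι → ℕ} {m : ℕ} (h : isPF f m) (i : ι) : f i < m := by
  by_contra hc
  push Not at hc
  have h1 := h m le_rfl
  have h2 : cnt f m = 0 := by omega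
  unfold cnt at h2
  rw [Finset.sum_eq_zero_iff] at h2
  have := h2 i (Finset.mem_univ i)
  simp [hc] at this

theorem mem_PF {ι : Type} [Fintype ι] {f : ι → ℕ} {m : ℕ} : f ∈ PF ι m ↔ isPF f m := by
  classical
  unfold PF
  simp only [Finset.mem_filter, Fintype.mem_piFinset, Finset.mem_range]
  exact ⟨fun h => h.2, fun h => ⟨h.lt, h⟩⟩

theorem cnt_comp {ι κ : Type} [Fintype ι] [Fintype κ] (e : ι ≃ κ) (f : κ → ℕ) (j : ℕ) :
    cnt (f ∘ e) j = cnt f j := by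
  unfold cnt
  exact e.sum_comp (fun i => if j ≤ f i then 1 else 0)

theorem card_PF_congr {ι κ : Type} [Fintype ι] [Fintype κ] (e : ι ≃ κ) (m : ℕ) :
    (PF ι m).card = (PF κ m).card := by
  apply Finset.card_nbij' (fun f => f ∘ e.symm) (fun f => f ∘ e)
  · intro f hf
    simp only [Finset.mem_coe, mem_PF] at hf ⊢
    intro j hj
    rw [cnt_comp]; exact hf j hj
  · intro f hf
    simp only [Finset.mem_coe, mem_PF] at hf ⊢
    intro j hj
    rw [cnt_comp]; exact hf j hj
  · intro f _
    funext x; simp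
  · intro f _
    funext x; simp

/-! ### the parking process -/

theorem occupied_concat (m : ℕ) (L : List ℕ) (a : ℕ) :
    occupied m (L ++ [a]) = parkStep m (occupied m L) a := by
  simp [occupied]

theorem parkStep_cases (m : ℕ) (occ : Finset ℕ) (a : ℕ) :
    (parkStep m occ a = occ ∧ Finset.Icc a m ⊆ occ) ∨
    ∃ s, a ≤ s ∧ s ≤ m ∧ s ∉ occ ∧ parkStep m occ a = insert s occ ∧
      ∀ x, a ≤ x → x < s → x ∈ occ := by
  unfold parkStep
  split_ifs with h
  · right
    have hm := Finset.min'_mem _ h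
    simp only [Finset.mem_sdiff, Finset.mem_Icc] at hm
    refine ⟨_, hm.1.1, hm.1.2, hm.2, rfl, ?_⟩
    intro x hx hxs
    by_contra hc
    have := Finset.min'_le (Finset.Icc a m \ occ) x (by
      simp only [Finset.mem_sdiff, Finset.mem_Icc]
      exact ⟨⟨hx, by omega⟩, hc⟩)
    omega
  · left
    refine ⟨rfl, ?_⟩
    rw [Finset.not_nonempty_iff_eq_empty, Finset.sdiff_eq_empty_iff_subset] at h
    exact h

theorem occupied_sub (m : ℕ) (L : List ℕ) (hL : ∀ a ∈ L, 1 ≤ a) :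
    occupied m L ⊆ Finset.Icc 1 m := by
  induction L using List.reverseRecOn with
  | nil => simp [occupied]
  | append_singleton L a ih =>
    have ih' := ih (fun b hb => hL b (by simp [hb]))
    have ha := hL a (by simp)
    rw [occupied_concat]
    rcases parkStep_cases m (occupied m L) a with ⟨h, _⟩ | ⟨s, h1, h2, h3, h4, _⟩
    · rw [h]; exact ih'
    · rw [h4]
      intro x hx
      rcases Finset.mem_insert.1 hx with rfl | hx
      · simp; omega
      · exact ih' hx

theorem card_occupied_le (m : ℕ) (L : List ℕ) : (occupied m L).card ≤ L.length := by
  induction L using List.reverseRecOn with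
  | nil => simp [occupied]
  | append_singleton L a ih =>
    rw [occupied_concat]
    rcases parkStep_cases m (occupied m L) a with ⟨h, _⟩ | ⟨s, h1, h2, h3, h4, _⟩
    · rw [h]; simp; omega
    · rw [h4, Finset.card_insert_of_notMem h3]; simp; omega

theorem count_le_of_full (m : ℕ) (L : List ℕ) (h : (occupied m L).card = L.length) (j : ℕ) :
    L.countP (fun a => j ≤ a) ≤ ((occupied m L).filter (fun x => j ≤ x)).card := by
  induction L using List.reverseRecOn with
  | nil => simp
  | append_singleton L a ih =>
    have hle := card_occupied_le m L
    rw [occupied_concat] at h ⊢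
    rw [List.countP_append]
    rcases parkStep_cases m (occupied m L) a with ⟨h0, _⟩ | ⟨s, h1, h2, h3, h4, _⟩
    · rw [h0] at h; simp at h; omega
    · rw [h4] at h ⊢
      rw [Finset.card_insert_of_notMem h3] at h
      have ih' := ih (by simp at h; exact h)
      rw [Finset.filter_insert]
      by_cases hja : j ≤ a
      · rw [if_pos (by omega), Finset.card_insert_of_notMem (by simp [h3])]
        simp [hja]; exact ih'
      · have : List.countP (fun a => decide (j ≤ a)) [a] = 0 := by simp; omega
        rw [this]
        refine le_trans ih' ?_
        split_ifs
        · exact Finset.card_le_card (Finset.subset_insert _ _)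
        · exact le_rfl

theorem filter_le_count (m : ℕ) (L : List ℕ) (x : ℕ) (hx : x ∉ occupied m L) :
    ((occupied m L).filter (fun y => x < y)).card ≤ L.countP (fun a => x + 1 ≤ a) := by
  induction L using List.reverseRecOn with
  | nil => simp [occupied]
  | append_singleton L a ih =>
    rw [occupied_concat] at hx ⊢
    rw [List.countP_append]
    rcases parkStep_cases m (occupied m L) a with ⟨h0, _⟩ | ⟨s, h1, h2, h3, h4, h5⟩
    · rw [h0] at hx ⊢
      have := ih hx
      omega
    · rw [h4] at hx ⊢
      simp only [Finset.mem_insert, not_or] at hx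
      have ih' := ih hx.2
      rw [Finset.filter_insert]
      split_ifs with hs
      · have hxa : x + 1 ≤ a := by
          by_contra hc
          exact hx.2 (h5 x (by omega) hs)
        have : List.countP (fun a => decide (x + 1 ≤ a)) [a] = 1 := by simp; omega
        rw [this]
        have := Finset.card_insert_le s ((occupied m L).filter (fun y => x < y))
        omega
      · omega

theorem exists_gap (occ : Finset ℕ) (m : ℕ) (h0 : 0 ∉ occ) (a : ℕ) (ha : 1 ≤ a)
    (h : Finset.Icc a m ⊆ occ) : ∃ x < a, x ∉ occ ∧ Finset.Icc (x+1) m ⊆ occ := by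
  induction a with
  | zero => omega
  | succ a ih =>
    by_cases hc : a ∈ occ
    · have : 1 ≤ a := by
        rcases Nat.eq_zero_or_pos a with rfl | h
        · exact absurd hc h0
        · exact h
      obtain ⟨x, hx, h1, h2⟩ := ih this (by
        intro y hy
        simp only [Finset.mem_Icc] at hy
        rcases Nat.lt_or_ge a y with h' | h'
        · exact h (by simp; omega)
        · have : y = a := by omega
          rw [this]; exact hc)
      exact ⟨x, by omega, h1, h2⟩
    · exact ⟨a, by omega, hc, h⟩

theorem full_of_count (m : ℕ) (L : List ℕ) (hL : ∀ a ∈ L, 1 ≤ a)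
    (h : ∀ j ≤ m, L.countP (fun a => j + 1 ≤ a) + j ≤ m) :
    (occupied m L).card = L.length := by
  induction L using List.reverseRecOn with
  | nil => simp [occupied]
  | append_singleton L a ih =>
    have hL' : ∀ b ∈ L, 1 ≤ b := fun b hb => hL b (by simp [hb])
    have ih' := ih hL' (fun j hj => by
      have := h j hj
      rw [List.countP_append] at this
      omega)
    have ha := hL a (by simp)
    have hsub := occupied_sub m L hL'
    have h0 : 0 ∉ occupied m L := fun hc => by have := hsub hc; simp at this
    rw [occupied_concat]
    rcases parkStep_cases m (occupied m L) a with ⟨_, h1⟩ | ⟨s, h1, h2, h3, h4, h5⟩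
    · exfalso
      have ham : a ≤ m := by
        by_contra hc
        have := h m le_rfl
        rw [List.countP_append] at this
        have h2 : List.countP (fun a => decide (m + 1 ≤ a)) [a] = 1 := by simp; omega
        omega
      obtain ⟨x, hx, hx1, hx2⟩ := exists_gap _ m h0 a ha h1
      have h3 := filter_le_count m L x hx1
      have h4 : (Finset.Icc (x+1) m).card ≤ ((occupied m L).filter (fun y => x < y)).card := by
        apply Finset.card_le_card
        intro y hy
        refine Finset.mem_filter.2 ⟨hx2 hy, ?_⟩
        simp at hy; omega
      rw [Nat.card_Icc] at h4
      have h5 := h x (by omega)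
      rw [List.countP_append] at h5
      have h6 : List.countP (fun a => decide (x + 1 ≤ a)) [a] = 1 := by simp; omega
      omega
    · rw [h4, Finset.card_insert_of_notMem h3]; simp; exact ih'

theorem flaws_zero_iff (m : ℕ) (L : List ℕ) (hL : ∀ a ∈ L, 1 ≤ a) :
    flaws m L = 0 ↔ ∀ j ≤ m, L.countP (fun a => j + 1 ≤ a) + j ≤ m := by
  have hle := card_occupied_le m L
  constructor
  · intro h j hj
    have hf : (occupied m L).card = L.length := by unfold flaws at h; omega
    have h1 := count_le_of_full m L hf (j+1)
    have h2 : ((occupied m L).filter (fun x => j + 1 ≤ x)).card ≤ (Finset.Icc (j+1) m).card := by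
      apply Finset.card_le_card
      intro y hy
      have hy' := Finset.mem_filter.1 hy
      have := occupied_sub m L hL hy'.1
      simp at this ⊢
      exact ⟨hy'.2, this.2⟩
    rw [Nat.card_Icc] at h2
    omega
  · intro h
    have := full_of_count m L hL h
    unfold flaws; omega

theorem prefList_eq {n s : ℕ} (f : Fin n → Fin s) :
    prefList f = List.ofFn (fun i => (f i : ℕ) + 1) := by
  unfold prefList
  simp [List.map_ofFn, Function.comp_def, ← List.map_eq_flatMap]

theorem countP_prefList {n s : ℕ} (f : Fin n → Fin s) (j : ℕ) :
    (prefList f).countP (fun a => j + 1 ≤ a) = cnt (fun i => (f i : ℕ)) j := by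
  rw [prefList_eq]
  unfold cnt
  induction n with
  | zero => simp
  | succ n ih =>
    rw [List.ofFn_succ, List.countP_cons, ih, Fin.sum_univ_succ]
    simp only [add_le_add_iff_right, decide_eq_true_eq]
    rw [add_comm]

theorem flaws_prefList {n m : ℕ} (f : Fin n → Fin m) :
    flaws m (prefList f) = 0 ↔ isPF (fun i => (f i : ℕ)) m := by
  rw [flaws_zero_iff]
  · simp only [countP_prefList]; rfl
  · intro a ha
    simp [prefList_eq, List.mem_ofFn] at ha
    obtain ⟨i, rfl⟩ := ha
    omega

theorem p_eq (n m : ℕ) : p n m m 0 = (PF (Fin n) m).card := by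
  unfold p
  apply Finset.card_bij (fun f _ => fun i => (f i : ℕ))
  · intro f hf
    rw [mem_PF, ← flaws_prefList]
    simpa using hf
  · intro f _ g _ h
    funext i
    exact Fin.ext (congrFun h i)
  · intro f hf
    rw [mem_PF] at hf
    refine ⟨fun i => ⟨f i, hf.lt i⟩, ?_, rfl⟩
    simp only [Finset.mem_filter, Finset.mem_univ, true_and]
    rw [flaws_prefList]; exact hf

theorem cnt_cons {N : ℕ} (a : ℕ) (b : Fin N → ℕ) (j : ℕ) :
    cnt (Fin.cons a b : Fin (N+1) → ℕ) j = cnt b j + if j ≤ a then 1 else 0 := by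
  unfold cnt
  rw [Fin.sum_univ_succ]
  simp [add_comm]

open Classical in
/-- Tails that extend `t` to a parking function. -/
noncomputable def TL (N m t : ℕ) : Finset (Fin N → ℕ) :=
  (Fintype.piFinset (fun _ => Finset.range m)).filter
    (fun b => isPF (Fin.cons t b : Fin (N+1) → ℕ) m)

theorem mem_TL {N m t : ℕ} {b : Fin N → ℕ} :
    b ∈ TL N m t ↔ ∀ j ≤ m, cnt b j + (if j ≤ t then 1 else 0) + j ≤ m := by
  have : isPF (Fin.cons t b : Fin (N+1) → ℕ) m ↔
      ∀ j ≤ m, cnt b j + (if j ≤ t then 1 else 0) + j ≤ m := by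
    unfold isPF; simp only [cnt_cons]
  rw [← this]
  unfold TL
  simp only [Finset.mem_filter, Fintype.mem_piFinset, Finset.mem_range]
  refine ⟨fun h => h.2, fun h => ⟨fun i => ?_, h⟩⟩
  simpa using h.lt i.succ

theorem pL_eq (N m t : ℕ) : pL (N+1) m m 0 (t+1) = (TL N m t).card := by
  unfold pL
  apply Finset.card_bij (fun f _ => fun i => (f i.succ : ℕ))
  · intro f hf
    simp only [Finset.mem_filter, Finset.mem_univ, true_and, flaws_prefList] at hf
    obtain ⟨h1, h2⟩ := hf
    have h3 : (f 0 : ℕ) = t := by simpa [prefList_eq, List.ofFn_succ] using h2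
    rw [mem_TL]
    intro j hj
    have := h1 j hj
    rw [← cnt_cons]
    convert this using 3
    funext i
    refine Fin.cases ?_ (fun i => ?_) i
    · simp [h3]
    · simp
  · intro f hf g hg h
    simp only [Finset.mem_filter, Finset.mem_univ, true_and, flaws_prefList] at hf hg
    have h3 : (f 0 : ℕ) = t := by simpa [prefList_eq, List.ofFn_succ] using hf.2
    have h4 : (g 0 : ℕ) = t := by simpa [prefList_eq, List.ofFn_succ] using hg.2
    funext i
    refine Fin.cases ?_ (fun i => ?_) i
    · exact Fin.ext (h3.trans h4.symm)
    · exact Fin.ext (congrFun h i)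
  · intro b hb
    have hb' : isPF (Fin.cons t b : Fin (N+1) → ℕ) m := by
      rw [mem_TL] at hb
      unfold isPF; simpa only [cnt_cons] using hb
    refine ⟨fun i => ⟨(Fin.cons t b : Fin (N+1) → ℕ) i, hb'.lt i⟩, ?_, ?_⟩
    · simp only [Finset.mem_filter, Finset.mem_univ, true_and, flaws_prefList]
      refine ⟨hb', ?_⟩
      simp [prefList_eq, List.ofFn_succ]
    · funext i; simp

/-! ### gluing -/

theorem cnt_split {N : ℕ} (S : Finset (Fin N)) (b : Fin N → ℕ) (j : ℕ) :
    cnt b j = cnt (fun x : {x // x ∈ S} => b x) j + cnt (fun x : {x // x ∉ S} => b x) j := by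
  unfold cnt
  rw [← Fintype.sum_subtype_add_sum_subtype (fun x => x ∈ S)
    (fun i => if j ≤ b i then 1 else 0)]
  congr 1
  exact Finset.sum_congr (by ext; simp) (fun _ _ => rfl)

theorem cnt_all {ι : Type} [Fintype ι] (f : ι → ℕ) (j : ℕ) (h : ∀ i, j ≤ f i) :
    cnt f j = Fintype.card ι := by
  simp [cnt, h]

theorem cnt_none {ι : Type} [Fintype ι] (f : ι → ℕ) (j : ℕ) (h : ∀ i, f i < j) :
    cnt f j = 0 := by
  simp [cnt, h]

theorem cnt_shift {ι : Type} [Fintype ι] (f : ι → ℕ) (j c : ℕ) :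
    cnt (fun i => f i + c) (j + c) = cnt f j := by
  simp [cnt]

/-- Combine two functions on a subset and its complement. -/
def glue {N : ℕ} (S : Finset (Fin N)) (t : ℕ) (g : {x // x ∈ S} → ℕ) (h : {x // x ∉ S} → ℕ) :
    Fin N → ℕ := fun x => if hx : x ∈ S then g ⟨x, hx⟩ else h ⟨x, hx⟩ + (t + 1)

theorem cnt_glue {N : ℕ} (S : Finset (Fin N)) (t : ℕ) (g : {x // x ∈ S} → ℕ)
    (h : {x // x ∉ S} → ℕ) (j : ℕ) :
    cnt (glue S t g h) j = cnt g j + cnt (fun x => h x + (t+1)) j := by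
  rw [cnt_split S]
  congr 2
  · funext x; simp [glue]
  · funext x; simp [glue, x.2]

theorem not_TL_iff {N m t : ℕ} {b : Fin N → ℕ} (htm : t + 1 ≤ m) :
    b ∈ TL N m t \ TL N m (t+1) ↔
      (∀ j ≤ m, cnt b j + (if j ≤ t then 1 else 0) + j ≤ m) ∧ cnt b (t+1) + (t+1) = m := by
  rw [Finset.mem_sdiff, mem_TL, mem_TL]
  refine and_congr_right fun h => ?_
  constructor
  · intro h2
    push Not at h2
    obtain ⟨j, hj, h3⟩ := h2
    have h4 := h j hj
    have : j = t + 1 := by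
      split_ifs at h3 h4 <;> omega
    subst this
    simp at h3 h4
    omega
  · intro h2 h3
    have := h3 (t+1) htm
    simp at this
    omega

theorem glue_mem {N m t : ℕ} (S : Finset (Fin N)) (hS : S.card + (m - (t+1)) = N)
    (htm : t + 1 ≤ m) (g : {x // x ∈ S} → ℕ) (h : {x // x ∉ S} → ℕ) (hg : ∀ x, g x < t) :
    glue S t g h ∈ TL N m t \ TL N m (t+1) ↔ isPF g t ∧ isPF h (m - (t+1)) := by
  have hc : Fintype.card {x // x ∉ S} = m - (t+1) := by
    rw [Fintype.card_subtype_compl]; simp; omega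
  have c1 : ∀ j ≤ t + 1, cnt (glue S t g h) j = cnt g j + (m - (t+1)) := by
    intro j hj
    rw [cnt_glue, cnt_all (fun x => h x + (t+1)) j (fun i => by omega), hc]
  have c0 : ∀ j, t ≤ j → cnt g j = 0 := fun j hj => cnt_none _ _ (fun i => by have := hg i; omega)
  have c2 : ∀ j, cnt (glue S t g h) (j + (t + 1)) = cnt h j := by
    intro j
    rw [cnt_glue, cnt_shift, c0 _ (by omega), zero_add]
  rw [not_TL_iff htm]
  constructor
  · rintro ⟨h1, h2⟩
    constructor
    · intro j hj
      have := h1 j (by omega)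
      rw [c1 j (by omega), if_pos hj] at this
      omega
    · intro j hj
      have := h1 (j + (t+1)) (by omega)
      rw [c2] at this
      omega
  · rintro ⟨h1, h2⟩
    constructor
    · intro j hj
      by_cases hjt : j ≤ t
      · have := h1 j hjt
        rw [c1 j (by omega), if_pos hjt]
        omega
      · obtain ⟨j, rfl⟩ : ∃ i, j = i + (t+1) := ⟨j - (t+1), by omega⟩
        have := h2 j (by omega)
        rw [c2, if_neg hjt]
        omega
    · rw [c1 _ le_rfl, c0 _ (by omega)]
      omega

theorem diff_struct {N m t : ℕ} (htm : t + 1 ≤ m) {b : Fin N → ℕ}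
    (hb : b ∈ TL N m t \ TL N m (t+1)) :
    (∀ x, b x ≠ t) ∧ (Finset.univ.filter (fun x => b x < t)).card + (m - (t+1)) = N := by
  rw [not_TL_iff htm] at hb
  obtain ⟨h1, h2⟩ := hb
  have h3 := h1 t (by omega)
  simp only [le_refl, if_true] at h3
  have hmono : ∀ x, (if t + 1 ≤ b x then 1 else 0) ≤ (if t ≤ b x then 1 else 0) := by
    intro x; split_ifs <;> omega
  have hne : ∀ x, b x ≠ t := by
    intro x hx
    have : cnt b (t+1) < cnt b t := by
      unfold cnt
      exact Finset.sum_lt_sum (fun i _ => hmono i) ⟨x, Finset.mem_univ x, by simp [hx]⟩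
    omega
  refine ⟨hne, ?_⟩
  have h4 : (Finset.univ.filter (fun x => b x < t)).card + cnt b (t+1) = N := by
    unfold cnt
    rw [Finset.card_filter, ← Finset.sum_add_distrib]
    calc _ = ∑ i : Fin N, 1 := Finset.sum_congr rfl (fun i _ => by
            have := hne i
            split_ifs <;> omega)
      _ = N := by simp
  omega

theorem fiber_card {N m t : ℕ} (S : Finset (Fin N)) (hS : S.card + (m - (t+1)) = N)
    (htm : t + 1 ≤ m) :
    ((TL N m t \ TL N m (t+1)).filter
      (fun b => Finset.univ.filter (fun x => b x < t) = S)).card =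
    (PF (Fin S.card) t).card * (PF (Fin (m - (t+1))) (m - (t+1))).card := by
  have e1 : (PF {x // x ∈ S} t).card = (PF (Fin S.card) t).card :=
    card_PF_congr (Fintype.equivFinOfCardEq (by simp)) t
  have e2 : (PF {x // x ∉ S} (m - (t+1))).card = (PF (Fin (m - (t+1))) (m - (t+1))).card :=
    card_PF_congr (Fintype.equivFinOfCardEq (by
      rw [Fintype.card_subtype_compl]; simp; omega)) _
  rw [← e1, ← e2, ← Finset.card_product]
  symm
  apply Finset.card_bij (fun q _ => glue S t q.1 q.2)
  · rintro ⟨g, h⟩ hq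
    simp only [Finset.mem_product, mem_PF] at hq
    rw [Finset.mem_filter]
    refine ⟨(glue_mem S hS htm g h hq.1.lt).2 hq, ?_⟩
    ext x
    simp only [Finset.mem_filter, Finset.mem_univ, true_and, glue]
    by_cases hx : x ∈ S
    · simp [hx, hq.1.lt]
    · simp [hx]; omega
  · rintro ⟨g, h⟩ _ ⟨g', h'⟩ _ heq
    simp only at heq
    refine Prod.ext ?_ ?_
    · funext x
      have := congrFun heq x
      simpa [glue] using this
    · funext x
      have := congrFun heq x
      simpa [glue, x.2] using this
  · intro b hb
    rw [Finset.mem_filter] at hb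
    obtain ⟨hb, hbS⟩ := hb
    have hmem : ∀ x, x ∈ S ↔ b x < t := by intro x; rw [← hbS]; simp
    have hne := (diff_struct htm hb).1
    have hgl : glue S t (fun x => b x) (fun x => b x - (t+1)) = b := by
      funext x
      unfold glue
      split_ifs with hx
      · rfl
      · have := hne x
        have := (hmem x).not.1 hx
        simp only
        omega
    refine ⟨(fun x => b x, fun x => b x - (t+1)), ?_, hgl⟩
    simp only [Finset.mem_product, mem_PF]
    rw [← glue_mem S hS htm _ _ (fun x => (hmem x).1 x.2), hgl]
    exact hb

/-- Theorem 4.3: for `n ≥ 1`, `k ≥ 0` and `k+1 ≤ l ≤ n+k-1`,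
`p^l_{n,n+k;≤n+k} - p^{l+1}_{n,n+k;≤n+k} = C(n-1, l-k-1) · p_{l-k-1,l-1;≤l-1} · p_{n+k-l}`. -/
theorem stmt4 (n k l : ℕ) (hn : 1 ≤ n) (hl1 : k + 1 ≤ l) (hl2 : l ≤ n + k - 1) :
    (pL n (n + k) (n + k) 0 l : ℤ) - pL n (n + k) (n + k) 0 (l + 1) =
      Nat.choose (n - 1) (l - k - 1) * p (l - k - 1) (l - 1) (l - 1) 0 *
        p (n + k - l) (n + k - l) (n + k - l) 0 := by
  obtain ⟨N, rfl⟩ : ∃ N, n = N + 1 := ⟨n - 1, by omega⟩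
  obtain ⟨t, rfl⟩ : ∃ t, l = t + 1 := ⟨l - 1, by omega⟩
  generalize hm : N + 1 + k = m at *
  have htm : t + 1 ≤ m := by omega
  have hsub : TL N m (t+1) ⊆ TL N m t := by
    intro b hb
    rw [mem_TL] at hb ⊢
    intro j hj
    have := hb j hj
    split_ifs at this ⊢ <;> omega
  have key : (TL N m t \ TL N m (t+1)).card =
      Nat.choose N (t - k) * ((PF (Fin (t-k)) t).card *
        (PF (Fin (m - (t+1))) (m - (t+1))).card) := by
    rw [Finset.card_eq_sum_card_fiberwise
      (f := fun b : Fin N → ℕ => Finset.univ.filter (fun x => b x < t))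
      (t := Finset.powersetCard (t-k) Finset.univ)]
    · rw [Finset.sum_congr rfl (fun S hS => (by
        have hc := (Finset.mem_powersetCard.1 hS).2
        rw [fiber_card S (by omega) htm, hc] : _ = (PF (Fin (t-k)) t).card *
          (PF (Fin (m - (t+1))) (m - (t+1))).card)), Finset.sum_const, Finset.card_powersetCard]
      simp
    · intro b hb
      have := (diff_struct htm hb).2
      simp only [Finset.mem_coe, Finset.mem_powersetCard, Finset.subset_univ, true_and]
      omega
  rw [pL_eq, pL_eq, p_eq, p_eq]
  have h1 : t + 1 - k - 1 = t - k := by omega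
  rw [h1, Nat.add_sub_cancel, Nat.add_sub_cancel]
  have h2 := Finset.card_sdiff_add_card_eq_card hsub
  rw [← h2, key]
  push_cast
  ring
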